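/- arXiv:1803.09296 — 2 statements merged into one kernel-verified Lean document; each statement's English description precedes it below -/
import Mathlib

section
/- Let β ∈ (0,1), (Ω, ℱ, ℙ) a probability space, 0 < t̄ < t, and E_{t̄}, E_t : Ω → ℝ integrable random variables with 0 < E_{t̄} ≤ E_t almost surely, 𝔼[E_{t̄}] = c·t̄^β and 𝔼[E_t] = c·t^β for some constant c > 0. Define u_β(x, r) := 𝔼[ min_{y ∈ ℝ^d} { E_r·L((x−y)/E_r) + g(y) } ] for r ∈ {t̄, t}. Then for every x ∈ ℝ^d, |u_β(x, t) − u_β(x, t̄)| ≤ C·(t − t̄)^β with C = c·max( L(0), sup_{|w| ≤ L_g} H(w) ). -/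
open Filter Set MeasureTheory
open scoped RealInnerProductSpace

/-- The Legendre transform `L(q) = sup_p (⟨p,q⟩ - H(p))` of a function
`H : ℝ^d → ℝ`. -/
noncomputable def legendreTransform {d : ℕ} (H : EuclideanSpace ℝ (Fin d) → ℝ)
    (q : EuclideanSpace ℝ (Fin d)) : ℝ :=
  ⨆ p : EuclideanSpace ℝ (Fin d), (⟪p, q⟫ - H p)

/-- A continuous superlinear function has a finite Legendre transform. -/
theorem bddAbove_legendre {d : ℕ} {H : EuclideanSpace ℝ (Fin d) → ℝ} (hH : Continuous H)
    (hHsuper : Tendsto (fun p : EuclideanSpace ℝ (Fin d) => H p / ‖p‖)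
      (comap (fun p => ‖p‖) atTop) atTop) (q : EuclideanSpace ℝ (Fin d)) :
    BddAbove (range fun p => ⟪p, q⟫ - H p) := by
  have h := hHsuper.eventually_ge_atTop ‖q‖
  rw [eventually_comap, eventually_atTop] at h
  obtain ⟨R, hR⟩ := h
  have hc : Continuous fun p => ⟪p, q⟫ - H p := by fun_prop
  obtain ⟨B, hB⟩ := (isCompact_closedBall (0 : EuclideanSpace ℝ (Fin d))
    (max R 1)).bddAbove_image hc.continuousOn
  refine ⟨max B 0, ?_⟩
  rintro _ ⟨p, rfl⟩
  by_cases hp : ‖p‖ ≤ max R 1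
  · exact (hB ⟨p, by simpa using hp, rfl⟩).trans (le_max_left _ _)
  · rw [not_le, max_lt_iff] at hp
    have h1 := hR ‖p‖ hp.1.le p rfl
    rw [le_div_iff₀ (by linarith)] at h1
    have h2 := real_inner_le_norm p q
    exact le_trans (by simp only; linarith [mul_comm ‖p‖ ‖q‖]) (le_max_right _ _)

theorem inner_sub_le_legendreTransform {d : ℕ} {H : EuclideanSpace ℝ (Fin d) → ℝ}
    {q : EuclideanSpace ℝ (Fin d)} (hb : BddAbove (range fun p => ⟪p, q⟫ - H p))
    (p : EuclideanSpace ℝ (Fin d)) : ⟪p, q⟫ - H p ≤ legendreTransform H q :=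
  le_ciSup hb p

/-- On a ball of radius `R`, testing the Legendre transform against a multiple of `q` bounds
`R * ‖q‖`. -/
theorem mul_norm_le_legendreTransform_add {d : ℕ} {H : EuclideanSpace ℝ (Fin d) → ℝ}
    {q : EuclideanSpace ℝ (Fin d)} (hb : BddAbove (range fun p => ⟪p, q⟫ - H p))
    {R : ℝ} (hR : 0 ≤ R) (hbH : BddAbove (H '' Metric.closedBall 0 R)) :
    R * ‖q‖ ≤ legendreTransform H q + sSup (H '' Metric.closedBall 0 R) := by
  have hmem : ‖(R * ‖q‖⁻¹) • q‖ ≤ R := by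
    rcases eq_or_ne q 0 with rfl | hq
    · simpa using hR
    · rw [norm_smul, Real.norm_of_nonneg (by positivity), mul_assoc,
        inv_mul_cancel₀ (norm_ne_zero_iff.2 hq), mul_one]
  have h1 := inner_sub_le_legendreTransform hb ((R * ‖q‖⁻¹) • q)
  have h2 : H ((R * ‖q‖⁻¹) • q) ≤ sSup (H '' Metric.closedBall 0 R) :=
    le_csSup hbH ⟨_, by simpa using hmem, rfl⟩
  have h3 : ⟪(R * ‖q‖⁻¹) • q, q⟫ = R * ‖q‖ := by
    rw [real_inner_smul_left, real_inner_self_eq_norm_sq]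
    rcases eq_or_ne q 0 with rfl | hq
    · simp
    · have := norm_ne_zero_iff.2 hq
      field_simp
  linarith

/-- The perspective `s ↦ s * L(v / s)` grows at rate at most `L 0`. -/
theorem mul_legendreTransform_inv_smul_le {d : ℕ} {H : EuclideanSpace ℝ (Fin d) → ℝ}
    (hb : ∀ q, BddAbove (range fun p => ⟪p, q⟫ - H p)) {s r : ℝ} (hs : 0 < s) (hsr : s ≤ r)
    (v : EuclideanSpace ℝ (Fin d)) :
    r * legendreTransform H (r⁻¹ • v) ≤
      s * legendreTransform H (s⁻¹ • v) + (r - s) * legendreTransform H 0 := by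
  have hr : 0 < r := hs.trans_le hsr
  rw [← le_div_iff₀' hr]
  refine ciSup_le fun p => ?_
  rw [le_div_iff₀' hr]
  have h1 := mul_le_mul_of_nonneg_left (inner_sub_le_legendreTransform (hb (s⁻¹ • v)) p) hs.le
  have h2 := mul_le_mul_of_nonneg_left (inner_sub_le_legendreTransform (hb 0) p)
    (sub_nonneg.2 hsr)
  rw [real_inner_smul_right, mul_sub, mul_inv_cancel_left₀ hs.ne'] at h1
  rw [real_inner_smul_right, mul_sub, mul_inv_cancel_left₀ hr.ne']
  rw [inner_zero_right] at h2
  linarith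

/-- The Hopf–Lax formula is Lipschitz in time. -/
theorem lipschitzOnWith_hopfLax {d : ℕ} {H : EuclideanSpace ℝ (Fin d) → ℝ}
    (hb : ∀ q, BddAbove (range fun p => ⟪p, q⟫ - H p))
    {g : EuclideanSpace ℝ (Fin d) → ℝ} {Lg : NNReal}
    (hbH : BddAbove (H '' Metric.closedBall 0 (Lg : ℝ)))
    (hgLip : LipschitzWith Lg g) (hgBdd : ∃ C, ∀ y, |g y| ≤ C) {K : NNReal}
    (hK0 : legendreTransform H 0 ≤ K) (hKH : sSup (H '' Metric.closedBall 0 (Lg : ℝ)) ≤ K)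
    (x : EuclideanSpace ℝ (Fin d)) :
    LipschitzOnWith K (fun s : ℝ => ⨅ y : EuclideanSpace ℝ (Fin d),
      (s * legendreTransform H (s⁻¹ • (x - y)) + g y)) (Ioi 0) := by
  obtain ⟨C, hC⟩ := hgBdd
  have hbelow : ∀ s : ℝ, 0 < s → BddBelow (range fun y : EuclideanSpace ℝ (Fin d) =>
      s * legendreTransform H (s⁻¹ • (x - y)) + g y) := by
    refine fun s hs => ⟨s * (-H 0) - C, ?_⟩
    rintro _ ⟨y, rfl⟩
    have h1 := inner_sub_le_legendreTransform (hb (s⁻¹ • (x - y))) 0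
    rw [inner_zero_left, zero_sub] at h1
    have h2 := mul_le_mul_of_nonneg_left h1 hs.le
    have h3 := neg_le_of_abs_le (hC y)
    simp only
    linarith
  have key : ∀ s r : ℝ, 0 < s → s ≤ r →
      |(⨅ y : EuclideanSpace ℝ (Fin d), (r * legendreTransform H (r⁻¹ • (x - y)) + g y)) -
        ⨅ y : EuclideanSpace ℝ (Fin d), (s * legendreTransform H (s⁻¹ • (x - y)) + g y)| ≤
      K * (r - s) := by
    intro s r hs hsr
    have hr : 0 < r := hs.trans_le hsr
    have hsr0 : 0 ≤ r - s := sub_nonneg.2 hsr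
    rw [abs_sub_comm, abs_sub_le_iff]
    constructor
    · rw [sub_le_comm]
      refine le_ciInf fun y => ?_
      set q := r⁻¹ • (x - y) with hq
      have hxy : x - y = r • q := by rw [hq, smul_inv_smul₀ hr.ne']
      have h1 := ciInf_le (hbelow s hs) (x - s • q)
      rw [sub_sub_cancel, inv_smul_smul₀ hs.ne'] at h1
      have h2 : g (x - s • q) ≤ g y + Lg * ((r - s) * ‖q‖) := by
        have h := hgLip.dist_le_mul (x - s • q) y
        rw [dist_eq_norm (x - s • q), sub_right_comm, hxy, ← sub_smul, norm_smul,
          Real.norm_of_nonneg hsr0, Real.dist_eq] at h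
        linarith [le_of_abs_le h]
      have h3 := mul_le_mul_of_nonneg_left
        ((mul_norm_le_legendreTransform_add (hb q) Lg.coe_nonneg hbH).trans
          (add_le_add_right hKH _)) hsr0
      linarith
    · rw [sub_le_comm]
      refine le_ciInf fun y => ?_
      have h1 := ciInf_le (hbelow r hr) y
      have h2 := mul_legendreTransform_inv_smul_le hb hs hsr (x - y)
      have h3 := mul_le_mul_of_nonneg_left hK0 hsr0
      linarith
  refine LipschitzOnWith.of_dist_le_mul fun r hr s hs => ?_
  rw [Real.dist_eq, Real.dist_eq]
  rcases le_total s r with h | h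
  · rw [abs_of_nonneg (sub_nonneg.2 h)]
    exact key s r hs h
  · rw [abs_sub_comm, abs_sub_comm r, abs_of_nonneg (sub_nonneg.2 h)]
    exact key r s hr h

theorem LipschitzWith.integrable_comp_real {Ω : Type*} [MeasurableSpace Ω] {P : Measure Ω}
    [IsFiniteMeasure P] {K : NNReal} {G : ℝ → ℝ} (hG : LipschitzWith K G) {X : Ω → ℝ}
    (hX : Integrable X P) : Integrable (fun ω => G (X ω)) P := by
  refine ((integrable_const |G 0|).add (hX.norm.const_mul (K : ℝ))).mono'
    (hG.continuous.comp_aestronglyMeasurable hX.1) (Eventually.of_forall fun ω => ?_)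
  have h := hG.dist_le_mul (X ω) 0
  rw [Real.dist_eq, Real.dist_eq, sub_zero] at h
  simp only [Real.norm_eq_abs, Pi.add_apply]
  linarith [abs_sub_abs_le_abs_sub (G (X ω)) (G 0)]

/-- Hölder continuity in time of the fractional Hopf–Lax function
`u_β(x,r) = 𝔼[min_y { E_r·L((x−y)/E_r) + g(y) }]`, `r ∈ {t̄, t}`, when
`𝔼[E_{t̄}] = c·t̄^β` and `𝔼[E_t] = c·t^β`:
`|u_β(x,t) − u_β(x,t̄)| ≤ C·(t − t̄)^β` with `C = c·max(L(0), sup_{|w| ≤ L_g} H(w))`. -/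
theorem stmt_9 {d : ℕ} (H : EuclideanSpace ℝ (Fin d) → ℝ)
    (hHconv : ConvexOn ℝ Set.univ H)
    (hHsuper : Tendsto (fun p : EuclideanSpace ℝ (Fin d) => H p / ‖p‖)
      (comap (fun p => ‖p‖) atTop) atTop)
    (g : EuclideanSpace ℝ (Fin d) → ℝ) (Lg : NNReal)
    (hgLip : LipschitzWith Lg g) (hgBdd : ∃ C, ∀ y, |g y| ≤ C)
    (β : ℝ) (hβ : β ∈ Set.Ioo (0 : ℝ) 1)
    {Ω : Type*} [MeasurableSpace Ω] (P : Measure Ω) [IsProbabilityMeasure P]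
    (tbar t : ℝ) (htbar : 0 < tbar) (htt : tbar < t)
    (Etbar Et : Ω → ℝ) (hEtbarInt : Integrable Etbar P) (hEtInt : Integrable Et P)
    (hpos : ∀ᵐ ω ∂P, 0 < Etbar ω ∧ Etbar ω ≤ Et ω)
    (c : ℝ) (hc : 0 < c)
    (hmoment_tbar : ∫ ω, Etbar ω ∂P = c * tbar ^ β)
    (hmoment_t : ∫ ω, Et ω ∂P = c * t ^ β) :
    ∀ x : EuclideanSpace ℝ (Fin d),
      |(∫ ω, (⨅ y : EuclideanSpace ℝ (Fin d),
            (Et ω * legendreTransform H ((Et ω)⁻¹ • (x - y)) + g y)) ∂P) -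
        ∫ ω, (⨅ y : EuclideanSpace ℝ (Fin d),
            (Etbar ω * legendreTransform H ((Etbar ω)⁻¹ • (x - y)) + g y)) ∂P| ≤
      c * max (legendreTransform H 0) (sSup (H '' Metric.closedBall 0 (Lg : ℝ))) *
        (t - tbar) ^ β := by
  intro x
  have hHc : Continuous H := continuousOn_univ.1 (hHconv.continuousOn isOpen_univ)
  have hb := bddAbove_legendre hHc hHsuper
  have hbH : BddAbove (H '' Metric.closedBall 0 (Lg : ℝ)) :=
    (isCompact_closedBall _ _).bddAbove_image hHc.continuousOn
  have hK0 := le_max_left (legendreTransform H 0) (sSup (H '' Metric.closedBall 0 (Lg : ℝ)))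
  have hKH := le_max_right (legendreTransform H 0) (sSup (H '' Metric.closedBall 0 (Lg : ℝ)))
  generalize max (legendreTransform H 0) (sSup (H '' Metric.closedBall 0 (Lg : ℝ))) = M
    at hK0 hKH ⊢
  have hM0 : 0 ≤ M := by
    have h1 := mul_norm_le_legendreTransform_add (hb 0) Lg.coe_nonneg hbH
    rw [norm_zero, mul_zero] at h1
    linarith
  lift M to NNReal using hM0
  obtain ⟨G, hG, hFG⟩ := (lipschitzOnWith_hopfLax hb hbH hgLip hgBdd
    hK0 hKH x).extend_real
  have e1 := integral_congr_ae (μ := P) (hpos.mono fun ω h => hFG (h.1.trans_le h.2))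
  have e2 := integral_congr_ae (μ := P) (hpos.mono fun ω h => hFG h.1)
  simp only at e1 e2
  rw [e1, e2, ← integral_sub (hG.integrable_comp_real hEtInt)
    (hG.integrable_comp_real hEtbarInt)]
  calc |∫ ω, (G (Et ω) - G (Etbar ω)) ∂P|
      ≤ ∫ ω, M * (Et ω - Etbar ω) ∂P := by
        rw [← Real.norm_eq_abs]
        refine norm_integral_le_of_norm_le ((hEtInt.sub hEtbarInt).const_mul _)
          (hpos.mono fun ω h => ?_)
        have h' := hG.dist_le_mul (Et ω) (Etbar ω)
        rwa [Real.dist_eq, Real.dist_eq, abs_of_nonneg (sub_nonneg.2 h.2)] at h'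
    _ = c * M * (t ^ β - tbar ^ β) := by
        rw [integral_const_mul, integral_sub hEtInt hEtbarInt, hmoment_t, hmoment_tbar]
        ring
    _ ≤ c * M * (t - tbar) ^ β := by
        gcongr
        have h := Real.rpow_add_le_add_rpow (sub_nonneg.2 htt.le) htbar.le hβ.1.le hβ.2.le
        rw [sub_add_cancel] at h
        linarith
end

section
/- Let β ∈ (0,1), t_0 > ε > 0 with t_0 − ε > 0, and define φ : [0,∞) → ℝ by φ(t) = t − (t_0 − ε) for t ∈ (t_0 − ε, t_0], φ(t) = (t_0 + ε) − t for t ∈ (t_0, t_0 + ε), and φ(t) = 0 otherwise. Then: (i) for t ∈ (t_0 − ε, t_0], ∂^β_{(0,t]} φ(t) = (t − t_0 + ε)^{1−β} / Γ(2−β); and (ii) for every t > 0, ∂^β_{(0,t]} φ(t) ≤ ε^{1−β} / Γ(2−β). Moreover φ(t_0) = ε, φ ≥ 0 and φ(0) = 0. -/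
open Filter Set MeasureTheory
open scoped Classical

/-- The Caputo fractional derivative of order `β ∈ (0,1)` of a function `f` on `[0,∞)`:
`∂^β f(t) = (1/Γ(1−β)) ∫_0^t f'(τ) (t−τ)^{−β} dτ`. -/
noncomputable def caputoDeriv (β : ℝ) (f : ℝ → ℝ) (t : ℝ) : ℝ :=
  (Real.Gamma (1 - β))⁻¹ * ∫ τ in Set.Ioc 0 t, deriv f τ * (t - τ) ^ (-β)

/-- The tent function `φ(t) = t − (t_0 − ε)` on `(t_0 − ε, t_0]`,
`φ(t) = (t_0 + ε) − t` on `(t_0, t_0 + ε)`, `φ = 0` otherwise. -/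
noncomputable def tentFunction (t₀ ε : ℝ) (t : ℝ) : ℝ :=
  if t ∈ Set.Ioc (t₀ - ε) t₀ then t - (t₀ - ε)
  else if t ∈ Set.Ioo t₀ (t₀ + ε) then (t₀ + ε) - t
  else 0

theorem setIntegral_sub_rpow_neg {β a b t : ℝ} (hβ : β < 1) (hab : a ≤ b) :
    ∫ τ in Ioc a b, (t - τ) ^ (-β) =
      ((t - a) ^ (1 - β) - (t - b) ^ (1 - β)) / (1 - β) := by
  rw [← intervalIntegral.integral_of_le hab,
    intervalIntegral.integral_comp_sub_left (fun x => x ^ (-β)) t,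
    integral_rpow (Or.inl (by linarith))]
  ring_nf

theorem integrableOn_sub_rpow_neg {β a b t : ℝ} (hβ : β < 1) :
    IntegrableOn (fun τ => (t - τ) ^ (-β)) (Ioc a b) := by
  have h : IntervalIntegrable (fun x : ℝ => x ^ (-β)) volume (t - a) (t - b) :=
    intervalIntegral.intervalIntegrable_rpow' (by linarith)
  have h' := h.comp_sub_left t
  simp only [sub_sub_cancel] at h'
  exact h'.1

theorem deriv_tentFunction_of_lt_left {t₀ ε τ : ℝ} (hε : 0 < ε) (h : τ < t₀ - ε) :
    deriv (tentFunction t₀ ε) τ = 0 := by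
  have : tentFunction t₀ ε =ᶠ[nhds τ] fun _ => 0 := by
    filter_upwards [Iio_mem_nhds h] with x hx
    rw [mem_Iio] at hx
    rw [tentFunction, if_neg (fun h => by linarith [h.1]), if_neg (fun h => by linarith [h.1])]
  rw [this.deriv_eq, deriv_const]

theorem deriv_tentFunction_of_mem_left {t₀ ε τ : ℝ} (h : τ ∈ Ioo (t₀ - ε) t₀) :
    deriv (tentFunction t₀ ε) τ = 1 := by
  have : tentFunction t₀ ε =ᶠ[nhds τ] fun x => x - (t₀ - ε) := by
    filter_upwards [Ioo_mem_nhds h.1 h.2] with x hx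
    rw [tentFunction, if_pos (Ioo_subset_Ioc_self hx)]
  rw [this.deriv_eq, deriv_sub_const, deriv_id'']

theorem deriv_tentFunction_nonpos_of_lt {t₀ ε τ : ℝ} (h : t₀ < τ) (hne : τ ≠ t₀ + ε) :
    deriv (tentFunction t₀ ε) τ ≤ 0 := by
  rcases hne.lt_or_gt with h' | h'
  · have : tentFunction t₀ ε =ᶠ[nhds τ] fun x => (t₀ + ε) - x := by
      filter_upwards [Ioo_mem_nhds h h'] with x hx
      rw [tentFunction, if_neg (fun h => by linarith [h.2, hx.1]), if_pos hx]
    rw [this.deriv_eq, deriv_const_sub, deriv_id'']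
    norm_num
  · have : tentFunction t₀ ε =ᶠ[nhds τ] fun _ => 0 := by
      filter_upwards [Ioi_mem_nhds h, Ioi_mem_nhds h'] with x hx hx'
      rw [mem_Ioi] at hx hx'
      rw [tentFunction, if_neg (fun h => by linarith [h.2]), if_neg (fun h => by linarith [h.2])]
    rw [this.deriv_eq, deriv_const]

theorem integral_deriv_tentFunction_mul {β t₀ ε t : ℝ} (hβ : β < 1) (hε : 0 < ε) (hεt₀ : ε < t₀)
    (ht : t ∈ Ioc (t₀ - ε) t₀) :
    ∫ τ in Ioc 0 t, deriv (tentFunction t₀ ε) τ * (t - τ) ^ (-β) =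
      (t - t₀ + ε) ^ (1 - β) / (1 - β) := by
  have hae : ∀ᵐ τ, τ ∈ Ioc 0 t → deriv (tentFunction t₀ ε) τ * (t - τ) ^ (-β) =
      (Ioc (t₀ - ε) t).indicator (fun τ => (t - τ) ^ (-β)) τ := by
    filter_upwards [Measure.ae_ne volume (t₀ - ε), Measure.ae_ne volume t₀] with τ h₁ h₂ hτ
    rcases h₁.lt_or_gt with h | h
    · rw [deriv_tentFunction_of_lt_left hε h, zero_mul,
        indicator_of_notMem (fun h' => by linarith [h'.1])]
    · rw [deriv_tentFunction_of_mem_left ⟨h, lt_of_le_of_ne (hτ.2.trans ht.2) h₂⟩, one_mul,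
        indicator_of_mem (show τ ∈ Ioc (t₀ - ε) t from ⟨h, hτ.2⟩)]
  rw [setIntegral_congr_ae measurableSet_Ioc hae, setIntegral_indicator measurableSet_Ioc,
    inter_eq_right.2 (Ioc_subset_Ioc_left (by linarith)),
    setIntegral_sub_rpow_neg hβ ht.1.le, sub_self, Real.zero_rpow (by linarith), sub_zero]
  ring_nf

theorem integral_deriv_tentFunction_mul_le {β t₀ ε t : ℝ} (hβ₀ : 0 < β) (hβ : β < 1) (hε : 0 < ε)
    (hεt₀ : ε < t₀) :
    ∫ τ in Ioc 0 t, deriv (tentFunction t₀ ε) τ * (t - τ) ^ (-β) ≤ ε ^ (1 - β) / (1 - β) := by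
  have hβ' : 0 < 1 - β := by linarith
  have hnonneg : 0 ≤ ε ^ (1 - β) / (1 - β) := by positivity
  rcases le_or_gt t (t₀ - ε) with h | h
  · refine le_of_eq_of_le (integral_eq_zero_of_ae ?_) hnonneg
    refine (ae_restrict_iff' measurableSet_Ioc).2 ?_
    filter_upwards [Measure.ae_ne volume (t₀ - ε)] with τ h₁ hτ
    rw [deriv_tentFunction_of_lt_left hε (lt_of_le_of_ne (hτ.2.trans h) h₁), zero_mul,
      Pi.zero_apply]
  rcases le_or_gt t t₀ with h' | h'
  · rw [integral_deriv_tentFunction_mul hβ hε hεt₀ ⟨h, h'⟩]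
    have : 0 ≤ t - t₀ + ε := by linarith
    gcongr
    linarith
  by_cases hint : IntegrableOn
      (fun τ => deriv (tentFunction t₀ ε) τ * (t - τ) ^ (-β)) (Ioc 0 t)
  swap
  · rwa [integral_undef hint]
  have hae : (fun τ => deriv (tentFunction t₀ ε) τ * (t - τ) ^ (-β)) ≤ᵐ[volume.restrict (Ioc 0 t)]
      (Ioc (t₀ - ε) t₀).indicator (fun τ => (t - τ) ^ (-β)) := by
    refine (ae_restrict_iff' measurableSet_Ioc).2 ?_
    filter_upwards [Measure.ae_ne volume (t₀ - ε), Measure.ae_ne volume t₀,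
      Measure.ae_ne volume (t₀ + ε)] with τ h₁ h₂ h₃ hτ
    rcases h₁.lt_or_gt with h | h
    · rw [deriv_tentFunction_of_lt_left hε h, zero_mul,
        indicator_of_notMem (fun h' => by linarith [h'.1])]
    rcases h₂.lt_or_gt with h' | h'
    · rw [deriv_tentFunction_of_mem_left ⟨h, h'⟩, one_mul,
        indicator_of_mem (show τ ∈ Ioc (t₀ - ε) t₀ from ⟨h, h'.le⟩)]
    · rw [indicator_of_notMem (fun h' => by linarith [h'.2])]
      exact mul_nonpos_of_nonpos_of_nonneg (deriv_tentFunction_nonpos_of_lt h' h₃)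
        (Real.rpow_nonneg (by linarith [hτ.2]) _)
  refine (integral_mono_ae hint
    ((integrableOn_sub_rpow_neg hβ).indicator measurableSet_Ioc) hae).trans ?_
  rw [setIntegral_indicator measurableSet_Ioc,
    inter_eq_right.2 (Ioc_subset_Ioc (by linarith) h'.le),
    setIntegral_sub_rpow_neg hβ (by linarith)]
  have hsub : (t - (t₀ - ε)) ^ (1 - β) ≤ (t - t₀) ^ (1 - β) + ε ^ (1 - β) := by
    rw [show t - (t₀ - ε) = (t - t₀) + ε by ring]
    exact Real.rpow_add_le_add_rpow (by linarith) hε.le hβ'.le (by linarith)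
  gcongr
  linarith

/-- Caputo derivative of the tent function `φ` centered at `t_0` with half-width `ε`:
(i) `∂^β φ(t) = (t − t_0 + ε)^{1−β}/Γ(2−β)` for `t ∈ (t_0 − ε, t_0]`;
(ii) `∂^β φ(t) ≤ ε^{1−β}/Γ(2−β)` for every `t > 0`;
moreover `φ(t_0) = ε`, `φ ≥ 0` and `φ(0) = 0`. -/
theorem stmt_16 (β : ℝ) (hβ : β ∈ Set.Ioo (0 : ℝ) 1)
    (t₀ ε : ℝ) (hε : 0 < ε) (hεt₀ : ε < t₀) :
    (∀ t ∈ Set.Ioc (t₀ - ε) t₀,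
      caputoDeriv β (tentFunction t₀ ε) t =
        (t - t₀ + ε) ^ (1 - β) / Real.Gamma (2 - β)) ∧
    (∀ t > (0 : ℝ),
      caputoDeriv β (tentFunction t₀ ε) t ≤ ε ^ (1 - β) / Real.Gamma (2 - β)) ∧
    tentFunction t₀ ε t₀ = ε ∧
    (∀ t, 0 ≤ tentFunction t₀ ε t) ∧
    tentFunction t₀ ε 0 = 0 := by
  obtain ⟨hβ₀, hβ₁⟩ := hβ
  have hβ' : 0 < 1 - β := by linarith
  have hΓ : 0 < Real.Gamma (1 - β) := Real.Gamma_pos_of_pos hβ'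
  have hΓ₂ : Real.Gamma (2 - β) = (1 - β) * Real.Gamma (1 - β) := by
    rw [← Real.Gamma_add_one hβ'.ne']
    ring_nf
  have hscale (x : ℝ) : x / Real.Gamma (2 - β) = (Real.Gamma (1 - β))⁻¹ * (x / (1 - β)) := by
    rw [hΓ₂]
    field_simp
  refine ⟨fun t ht => ?_, fun t _ => ?_, ?_, fun t => ?_, ?_⟩
  · rw [caputoDeriv, integral_deriv_tentFunction_mul hβ₁ hε hεt₀ ht, hscale]
  · rw [caputoDeriv, hscale]
    gcongr
    exact integral_deriv_tentFunction_mul_le hβ₀ hβ₁ hε hεt₀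
  · rw [tentFunction, if_pos ⟨by linarith, le_rfl⟩]
    ring
  · rw [tentFunction]
    split_ifs with h₁ h₂
    · linarith [h₁.1]
    · linarith [h₂.2]
    · exact le_rfl
  · rw [tentFunction, if_neg (fun h => by linarith [h.1]), if_neg (fun h => by linarith [h.1])]
end
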